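/- In the group G = ⟨a, b | b²a⁻²b² = a⁻¹b³a⁻¹⟩, the element a⁻¹bab⁻¹ is a generalized torsion element of G, i.e., a⁻¹bab⁻¹ ≠ 1 and some nonempty finite product of its conjugates equals 1. -/

import Mathlib

/-- The 5₂ knot group ⟨a, b | b²a⁻²b² = a⁻¹b³a⁻¹⟩, with a ↦ true, b ↦ false. -/
def FiveTwoRels : Set (FreeGroup Bool) :=
  {FreeGroup.of false ^ 2 * (FreeGroup.of true)⁻¹ ^ 2 * FreeGroup.of false ^ 2 *
    ((FreeGroup.of true)⁻¹ * FreeGroup.of false ^ 3 * (FreeGroup.of true)⁻¹)⁻¹}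

/-- In a bi-invariantly preordered group, `b ^ 2 * a⁻² * b ^ 2 = a⁻¹ * b ^ 3 * a⁻¹` is incompatible
with `b < a⁻¹ * b * a`. -/
theorem not_lt_conj_of_fiveTwo_rel {G : Type*} [Group G] [Preorder G] [MulLeftStrictMono G]
    [MulRightStrictMono G] {a b : G}
    (h : b ^ 2 * a⁻¹ ^ 2 * b ^ 2 = a⁻¹ * b ^ 3 * a⁻¹) : ¬ b < a⁻¹ * b * a := by
  intro h01
  have conj_lt {x y : G} (g : G) (hxy : x < y) : g⁻¹ * x * g < g⁻¹ * y * g :=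
    mul_lt_mul_left (mul_lt_mul_right hxy g⁻¹) g
  have sq_lt {x y : G} (hxy : x < y) : x ^ 2 < y ^ 2 := by
    rw [pow_two, pow_two]
    exact mul_lt_mul_of_lt_of_lt hxy hxy
  have h12 := conj_lt a h01
  set b₁ := a⁻¹ * b * a with hb₁
  set b₂ := a⁻¹ * b₁ * a with hb₂
  have hrel : b ^ 2 * b₂ ^ 2 = b₁ ^ 3 := by
    have h₁ : b ^ 2 * b₂ ^ 2 = b ^ 2 * a⁻¹ ^ 2 * b ^ 2 * a ^ 2 := by
      simp [hb₁, hb₂, pow_succ, mul_assoc]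
    have h₂ : b₁ ^ 3 = a⁻¹ * b ^ 3 * a⁻¹ * a ^ 2 := by
      simp [hb₁, pow_succ, mul_assoc]
    rw [h₁, h₂, h]
  have hlow : b ^ 2 < b₁ := by
    have : b ^ 2 * b₁ ^ 2 < b₁ * b₁ ^ 2 := by
      rw [← pow_succ', ← hrel]
      exact mul_lt_mul_right (sq_lt h12) _
    exact lt_of_mul_lt_mul_right' this
  have hupp : b₁ < b₂ ^ 2 := by
    have : b₁ ^ 2 * b₁ < b₁ ^ 2 * b₂ ^ 2 := by
      rw [← pow_succ, ← hrel]
      exact mul_lt_mul_left (sq_lt h01) _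
    exact lt_of_mul_lt_mul_left' this
  have hlow' : b₁ ^ 2 < b₂ := by
    have := conj_lt a hlow
    rwa [show a⁻¹ * b ^ 2 * a = b₁ ^ 2 by simp [hb₁, pow_succ, mul_assoc]] at this
  have hupp' : b < b₁ ^ 2 := by
    have := conj_lt a⁻¹ hupp
    rwa [show a⁻¹⁻¹ * b₁ * a⁻¹ = b by simp [hb₁, mul_assoc],
      show a⁻¹⁻¹ * b₂ ^ 2 * a⁻¹ = b₁ ^ 2 by simp [hb₂, pow_succ, mul_assoc]] at this
  have hneg : b ^ 3 < 1 := by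
    have : b ^ 2 * b₁ * b₁ ^ 3 < 1 * b₁ ^ 3 := by
      rw [one_mul, mul_assoc, ← pow_succ', ← hrel, show b₁ ^ (3 + 1) = (b₁ ^ 2) ^ 2 by group]
      exact mul_lt_mul_right (sq_lt hlow') _
    rw [pow_succ]
    exact (mul_lt_mul_right h01 _).trans (lt_of_mul_lt_mul_right' this)
  have hpos : 1 < b₂ ^ 3 := by
    have : b₁ ^ 3 * 1 < b₁ ^ 3 * (b₁ * b₂ ^ 2) := by
      rw [mul_one, ← mul_assoc, ← pow_succ, ← hrel, show b₁ ^ (3 + 1) = (b₁ ^ 2) ^ 2 by group]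
      exact mul_lt_mul_left (sq_lt hupp') _
    rw [pow_succ']
    exact (lt_of_mul_lt_mul_left' this).trans (mul_lt_mul_left h12 _)
  have hneg' := conj_lt (a ^ 2) hneg
  rw [show (a ^ 2)⁻¹ * b ^ 3 * a ^ 2 = b₂ ^ 3 by simp [hb₁, hb₂, pow_succ, mul_assoc],
    mul_one, inv_mul_cancel] at hneg'
  exact lt_irrefl _ (hpos.trans hneg')

/-- `x` is a nonempty product of conjugates of `c`. -/
def IsConjProd {G : Type*} [Group G] (c x : G) : Prop :=
  ∃ l : List G, l ≠ [] ∧ (l.map (fun g => g⁻¹ * c * g)).prod = x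

namespace IsConjProd

variable {G : Type*} [Group G] {c x y : G}

theorem of_conj (g : G) : IsConjProd c (g⁻¹ * c * g) :=
  ⟨[g], by simp, by simp⟩

theorem mul (hx : IsConjProd c x) (hy : IsConjProd c y) : IsConjProd c (x * y) := by
  obtain ⟨l, hl, rfl⟩ := hx
  obtain ⟨m, -, rfl⟩ := hy
  exact ⟨l ++ m, by simp [hl], by simp⟩

theorem conj (hx : IsConjProd c x) (k : G) : IsConjProd c (k⁻¹ * x * k) := by
  obtain ⟨l, hl, rfl⟩ := hx
  refine ⟨l.map (· * k), by simpa using hl, ?_⟩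
  clear hl
  induction l with
  | nil => simp
  | cons g l ih =>
    simp only [List.map_cons, List.prod_cons, ih]
    group

/-- If `1` is not a nonempty product of conjugates of `c`, then these products are the positive
elements of a bi-invariant preorder. -/
abbrev preorder (h : ¬ IsConjProd c 1) : Preorder G where
  le x y := x = y ∨ IsConjProd c (x⁻¹ * y)
  lt x y := IsConjProd c (x⁻¹ * y)
  le_refl _ := Or.inl rfl
  le_trans x y z := by
    rintro (rfl | hxy) (rfl | hyz)
    · exact Or.inl rfl
    · exact Or.inr hyz
    · exact Or.inr hxy
    · exact Or.inr (by simpa [mul_assoc] using hxy.mul hyz)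
  lt_iff_le_not_ge x y := by
    constructor
    · refine fun hxy => ⟨Or.inr hxy, ?_⟩
      rintro (rfl | hyx)
      · exact h (by simpa using hxy)
      · exact h (by simpa [mul_assoc] using hxy.mul hyx)
    · rintro ⟨rfl | hxy, hyx⟩
      · exact absurd (Or.inl rfl) hyx
      · exact hxy

end IsConjProd

theorem isConjProd_one_of_fiveTwo_rel {G : Type*} [Group G] {a b : G}
    (h : b ^ 2 * a⁻¹ ^ 2 * b ^ 2 = a⁻¹ * b ^ 3 * a⁻¹) :
    IsConjProd (a⁻¹ * b * a * b⁻¹) 1 := by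
  by_contra hc
  let _ := IsConjProd.preorder hc
  have : MulLeftStrictMono G := ⟨fun g x y (hxy : IsConjProd _ (x⁻¹ * y)) => by
    change IsConjProd _ ((g * x)⁻¹ * (g * y))
    simpa [mul_assoc] using hxy⟩
  have : MulRightStrictMono G := ⟨fun g x y (hxy : IsConjProd _ (x⁻¹ * y)) => by
    change IsConjProd _ ((x * g)⁻¹ * (y * g))
    simpa [mul_assoc] using hxy.conj g⟩
  refine not_lt_conj_of_fiveTwo_rel h ?_
  change IsConjProd _ (b⁻¹ * (a⁻¹ * b * a))
  simpa [mul_assoc] using IsConjProd.of_conj (c := a⁻¹ * b * a * b⁻¹) b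

/-- The homomorphism onto the dihedral group of order 14 sending `a` to a reflection and `b` to a
rotation. -/
def fiveTwoToDihedral : PresentedGroup FiveTwoRels →* DihedralGroup 7 :=
  PresentedGroup.toGroup (f := fun i => if i then DihedralGroup.sr 0 else DihedralGroup.r 1) <| by
    rintro r rfl
    simp only [map_mul, map_inv, map_pow, FreeGroup.lift_apply_of]
    decide

theorem fiveTwo_generalized_torsion :
    let a : PresentedGroup FiveTwoRels := PresentedGroup.of true
    let b : PresentedGroup FiveTwoRels := PresentedGroup.of false
    a⁻¹ * b * a * b⁻¹ ≠ 1 ∧ ∃ l : List (PresentedGroup FiveTwoRels), l ≠ [] ∧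
      (l.map (fun g => g⁻¹ * (a⁻¹ * b * a * b⁻¹) * g)).prod = 1 := by
  intro a b
  constructor
  · intro h
    have := congrArg fiveTwoToDihedral h
    simp only [a, b, fiveTwoToDihedral, map_mul, map_inv, map_one,
      PresentedGroup.toGroup.of] at this
    revert this
    decide
  · refine isConjProd_one_of_fiveTwo_rel ?_
    have := PresentedGroup.one_of_mem (rels := FiveTwoRels) rfl
    simp only [map_mul, map_inv, map_pow] at this
    exact mul_inv_eq_one.mp this
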